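/- Let 0 < α < 1, r > 0, T > 0, let f : [0,T] × ℝ × ℝ → ℝ be continuous, and let φ : [−r,0] → ℝ be continuous. Assume there is a constant L > 0 such that |f(t,υ₁,ϑ) − f(t,υ₂,ϑ)| ≤ L|υ₁ − υ₂| for all υ₁,υ₂,ϑ ∈ ℝ and t ∈ [0,T] (a Lipschitz condition in the second variable only). Then there exists a unique continuous function υ : [−r,T] → ℝ such that υ(t) = φ(t) for t ∈ [−r,0] and υ(t) = φ(0) + (1/Γ(α)) ∫₀ᵗ (t−s)^{α−1} f(s, υ(s), υ(s−r)) ds for t ∈ [0,T]. -/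

import Mathlib

open Real Set

/-- `υ` solves the integral form of the Caputo fractional problem with constant delay `r`:
`ᶜD^α υ(t) = f(t, υ(t), υ(t-r))` on `[0,T]` with initial data `φ` on `[-r,0]`. -/
def SolvesConstDelayFDDE (α r T : ℝ) (f : ℝ → ℝ → ℝ → ℝ) (φ υ : ℝ → ℝ) : Prop :=
  ContinuousOn υ (Set.Icc (-r) T) ∧
  (∀ t ∈ Set.Icc (-r) 0, υ t = φ t) ∧
  (∀ t ∈ Set.Icc 0 T, υ t = φ 0 +
    (1 / Real.Gamma α) * ∫ s in (0:ℝ)..t, (t - s) ^ (α - 1) * f s (υ s) (υ (s - r)))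

open MeasureTheory Filter Topology

section VolterraRpowKernel

variable {α t : ℝ}

lemma intervalIntegrable_sub_rpow_mul (hα : 0 < α) (ht : 0 ≤ t) {h : ℝ → ℝ}
    (hh : ContinuousOn h (Icc 0 t)) :
    IntervalIntegrable (fun s => (t - s) ^ (α - 1) * h s) volume 0 t := by
  have h1 : IntervalIntegrable (fun s : ℝ => s ^ (α - 1)) volume 0 t :=
    intervalIntegral.intervalIntegrable_rpow' (by linarith)
  have h2 := (h1.comp_sub_left t).symm
  simp only [sub_zero, sub_self] at h2
  exact h2.mul_continuousOn (by rwa [uIcc_of_le ht])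

lemma integral_sub_rpow_mul_exp_le (hα : 0 < α) (ht : 0 ≤ t) {c : ℝ} (hc : 0 < c) :
    ∫ s in (0:ℝ)..t, (t - s) ^ (α - 1) * exp (c * s) ≤
      exp (c * t) * ((1 / c) ^ α * Gamma α) := by
  have h1 : ∫ s in (0:ℝ)..t, (t - s) ^ (α - 1) * exp (c * s) =
      exp (c * t) * ∫ s in (0:ℝ)..t, s ^ (α - 1) * exp (-(c * s)) := by
    have := intervalIntegral.integral_comp_sub_left (a := 0) (b := t)
      (fun s : ℝ => s ^ (α - 1) * exp (c * (t - s))) t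
    simp only [sub_sub_cancel, sub_zero, sub_self] at this
    rw [this, ← intervalIntegral.integral_const_mul]
    refine intervalIntegral.integral_congr fun s _ => ?_
    have : c * (t - s) = c * t + -(c * s) := by ring
    simp only [this, exp_add]
    ring
  rw [h1]
  refine mul_le_mul_of_nonneg_left ?_ (exp_pos _).le
  rw [← integral_rpow_mul_exp_neg_mul_Ioi hα hc, intervalIntegral.integral_of_le ht]
  refine setIntegral_mono_set ?_ ?_ (Ioc_subset_Ioi_self.eventuallyLE)
  · by_contra hn
    have := integral_undef hn
    rw [integral_rpow_mul_exp_neg_mul_Ioi hα hc] at this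
    have : 0 < (1 / c) ^ α * Gamma α := mul_pos (rpow_pos_of_pos (by positivity) _)
      (Gamma_pos_of_pos hα)
    linarith
  · filter_upwards [ae_restrict_mem measurableSet_Ioi] with s hs
    exact mul_nonneg (rpow_nonneg (le_of_lt hs) _) (exp_pos _).le

lemma abs_integral_sub_rpow_mul_le (hα : 0 < α) (ht : 0 ≤ t) {c M : ℝ} (hc : 0 < c)
    (hM : 0 ≤ M) {h : ℝ → ℝ} (hh : ∀ s ∈ Icc 0 t, |h s| ≤ M * exp (c * s)) :
    |∫ s in (0:ℝ)..t, (t - s) ^ (α - 1) * h s| ≤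
      M * (exp (c * t) * ((1 / c) ^ α * Gamma α)) := by
  have h1 : ‖∫ s in (0:ℝ)..t, (t - s) ^ (α - 1) * h s‖ ≤
      ∫ s in (0:ℝ)..t, M * ((t - s) ^ (α - 1) * exp (c * s)) := by
    refine intervalIntegral.norm_integral_le_of_norm_le ht (ae_of_all _ fun s hs => ?_)
      ((intervalIntegrable_sub_rpow_mul hα ht (by fun_prop)).const_mul M)
    have h2 : 0 ≤ (t - s) ^ (α - 1) := rpow_nonneg (by linarith [hs.2]) _
    rw [norm_eq_abs, abs_mul, abs_of_nonneg h2]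
    calc _ ≤ (t - s) ^ (α - 1) * (M * exp (c * s)) :=
          mul_le_mul_of_nonneg_left (hh s ⟨hs.1.le, hs.2⟩) h2
      _ = _ := by ring
  rw [intervalIntegral.integral_const_mul] at h1
  exact h1.trans (mul_le_mul_of_nonneg_left (integral_sub_rpow_mul_exp_le hα ht hc) hM)

lemma continuousOn_integral_sub_rpow_mul (hα : 0 < α) {T : ℝ} {h : ℝ → ℝ}
    (hh : Continuous h) :
    ContinuousOn (fun t => ∫ s in (0:ℝ)..t, (t - s) ^ (α - 1) * h s) (Icc 0 T) := by
  obtain ⟨C, hC⟩ := (isCompact_Icc (a := (0:ℝ)) (b := T)).exists_bound_of_continuousOn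
    hh.continuousOn
  have key : ∀ t ∈ Icc 0 T, ∫ s in (0:ℝ)..t, (t - s) ^ (α - 1) * h s =
      ∫ s in Ioc 0 T, (Iic t).indicator (fun s => s ^ (α - 1) * h (t - s)) s := by
    intro t ht
    have := intervalIntegral.integral_comp_sub_left (a := 0) (b := t)
      (fun s : ℝ => s ^ (α - 1) * h (t - s)) t
    simp only [sub_sub_cancel, sub_zero, sub_self] at this
    rw [this, intervalIntegral.integral_of_le ht.1, setIntegral_indicator measurableSet_Iic,
      Ioc_inter_Iic, min_eq_right ht.2]
  refine ContinuousOn.congr (fun t₀ ht₀ => ?_) key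
  have hint : IntegrableOn (fun s : ℝ => s ^ (α - 1)) (Ioc 0 T) :=
    (intervalIntegral.intervalIntegrable_rpow' (a := 0) (b := T) (by linarith)).1
  refine continuousWithinAt_of_dominated (bound := fun s => s ^ (α - 1) * C) ?_ ?_
    (hint.mul_const C) ?_
  · refine Eventually.of_forall fun t => ?_
    refine AEStronglyMeasurable.indicator ?_ measurableSet_Iic
    exact hint.aestronglyMeasurable.mul
      (by fun_prop : Continuous fun s => h (t - s)).aestronglyMeasurable
  · filter_upwards [self_mem_nhdsWithin] with t ht
    filter_upwards [ae_restrict_mem measurableSet_Ioc] with s hs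
    have h2 : 0 ≤ s ^ (α - 1) := rpow_nonneg hs.1.le _
    by_cases hst : s ≤ t
    · rw [indicator_of_mem (by exact hst), norm_mul, norm_of_nonneg h2]
      exact mul_le_mul_of_nonneg_left
        (hC _ ⟨by linarith, by linarith [ht.2, hs.1]⟩) h2
    · rw [indicator_of_notMem (by exact hst), norm_zero]
      exact mul_nonneg h2 ((norm_nonneg _).trans (hC t ht))
  · have hne : ∀ᵐ s ∂(volume.restrict (Ioc 0 T)), s ≠ t₀ :=
      ae_restrict_of_ae (by simp [ae_iff])
    filter_upwards [hne] with s hs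
    refine ContinuousAt.continuousWithinAt ?_
    rcases lt_or_gt_of_ne hs with hlt | hgt
    · have hc : ContinuousAt (fun t => s ^ (α - 1) * h (t - s)) t₀ := by fun_prop
      refine hc.congr ?_
      filter_upwards [lt_mem_nhds hlt] with t ht
      rw [indicator_of_mem (by exact ht.le)]
    · refine (continuousAt_const (y := (0:ℝ))).congr ?_
      filter_upwards [gt_mem_nhds hgt] with t ht
      rw [indicator_of_notMem (by simpa using ht)]

/-- The exponential weight that makes the fractional integral `1 / 2`-contracting. -/
lemma exists_weight (hα : 0 < α) {L : ℝ} (hL : 0 < L) :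
    ∃ c : ℝ, 0 < c ∧ L * (1 / c) ^ α = 1 / 2 := by
  refine ⟨(2 * L) ^ (1 / α), by positivity, ?_⟩
  rw [one_div ((2 * L) ^ (1 / α)), inv_rpow (by positivity), ← rpow_mul (by positivity),
    one_div_mul_cancel hα.ne', rpow_one]
  field_simp

lemma abs_fractionalIntegral_sub_le (hα : 0 < α) (ht : 0 ≤ t) {L c M : ℝ} (hL : 0 < L)
    (hc : 0 < c) (hcL : L * (1 / c) ^ α = 1 / 2) (hM : 0 ≤ M) {h₁ h₂ : ℝ → ℝ}
    (hh₁ : ContinuousOn h₁ (Icc 0 t)) (hh₂ : ContinuousOn h₂ (Icc 0 t))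
    (hle : ∀ s ∈ Icc 0 t, |h₁ s - h₂ s| ≤ L * M * exp (c * s)) :
    |(1 / Gamma α) * (∫ s in (0:ℝ)..t, (t - s) ^ (α - 1) * h₁ s) -
      (1 / Gamma α) * ∫ s in (0:ℝ)..t, (t - s) ^ (α - 1) * h₂ s| ≤ M / 2 * exp (c * t) := by
  have hG := Gamma_pos_of_pos hα
  rw [← mul_sub, ← intervalIntegral.integral_sub (intervalIntegrable_sub_rpow_mul hα ht hh₁)
    (intervalIntegrable_sub_rpow_mul hα ht hh₂)]
  simp only [← mul_sub]
  have h1 := abs_integral_sub_rpow_mul_le hα ht hc (by positivity : 0 ≤ L * M) hle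
  rw [abs_mul, abs_of_pos (by positivity : 0 < 1 / Gamma α)]
  calc _ ≤ 1 / Gamma α * (L * M * (exp (c * t) * ((1 / c) ^ α * Gamma α))) :=
        mul_le_mul_of_nonneg_left h1 (by positivity)
    _ = (L * (1 / c) ^ α) * M * exp (c * t) := by field_simp
    _ = _ := by rw [hcL]; ring

lemma fractionalVolterra_eqOn (hα : 0 < α) {L a x₀ : ℝ} (hL : 0 < L)
    {g : ℝ → ℝ → ℝ} {u v : ℝ → ℝ}
    (hLip : ∀ t ∈ Icc 0 a, ∀ x y, |g t x - g t y| ≤ L * |x - y|)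
    (hu : ContinuousOn u (Icc 0 a)) (hv : ContinuousOn v (Icc 0 a))
    (hgu : ContinuousOn (fun s => g s (u s)) (Icc 0 a))
    (hgv : ContinuousOn (fun s => g s (v s)) (Icc 0 a))
    (hu' : ∀ t ∈ Icc 0 a, u t = x₀ +
      (1 / Gamma α) * ∫ s in (0:ℝ)..t, (t - s) ^ (α - 1) * g s (u s))
    (hv' : ∀ t ∈ Icc 0 a, v t = x₀ +
      (1 / Gamma α) * ∫ s in (0:ℝ)..t, (t - s) ^ (α - 1) * g s (v s)) :
    EqOn u v (Icc 0 a) := by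
  obtain ⟨c, hc, hcL⟩ := exists_weight hα hL
  rcases lt_or_ge a 0 with ha | ha
  · simp [Icc_eq_empty_of_lt ha]
  have hcont : ContinuousOn (fun s => |u s - v s| * exp (-(c * s))) (Icc 0 a) := by fun_prop
  obtain ⟨t, ht, hmax⟩ := isCompact_Icc.exists_isMaxOn ⟨0, left_mem_Icc.2 ha⟩ hcont
  set M := |u t - v t| * exp (-(c * t)) with hMdef
  have hM : 0 ≤ M := by positivity
  have hbound : ∀ s ∈ Icc 0 a, |u s - v s| ≤ M * exp (c * s) := by
    intro s hs
    have h1 : |u s - v s| * exp (-(c * s)) ≤ M := hmax hs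
    rwa [exp_neg, ← div_eq_mul_inv, div_le_iff₀ (exp_pos _)] at h1
  have hsub : Icc 0 t ⊆ Icc 0 a := Icc_subset_Icc_right ht.2
  have h2 := abs_fractionalIntegral_sub_le hα ht.1 hL hc hcL hM (hgu.mono hsub) (hgv.mono hsub)
    (fun s hs => (hLip s (hsub hs) _ _).trans <| by
      rw [mul_assoc]
      exact mul_le_mul_of_nonneg_left (hbound s (hsub hs)) hL.le)
  have h3 : |u t - v t| ≤ M / 2 * exp (c * t) := by
    rw [hu' t ht, hv' t ht, add_sub_add_left_eq_sub]
    exact h2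
  have h4 : M ≤ M / 2 := by
    rwa [← div_le_iff₀ (exp_pos _), div_eq_mul_inv, ← exp_neg] at h3
  have hM0 : M = 0 := by linarith
  intro s hs
  have h5 := hbound s hs
  rw [hM0, zero_mul] at h5
  exact sub_eq_zero.1 (abs_nonpos_iff.1 h5)

lemma fractionalVolterra_exists (hα : 0 < α) {L T : ℝ} (x₀ : ℝ) (hL : 0 < L) (hT : 0 ≤ T)
    {g : ℝ → ℝ → ℝ} (hg : Continuous fun p : ℝ × ℝ => g p.1 p.2)
    (hLip : ∀ t x y, |g t x - g t y| ≤ L * |x - y|) :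
    ∃ u : ℝ → ℝ, Continuous u ∧ ∀ t ∈ Icc 0 T, u t = x₀ +
      (1 / Gamma α) * ∫ s in (0:ℝ)..t, (t - s) ^ (α - 1) * g s (u s) := by
  obtain ⟨c, hc, hcL⟩ := exists_weight hα hL
  let e : C(Icc 0 T, ℝ) → ℝ → ℝ := fun v s => exp (c * s) * IccExtend hT v s
  have he : ∀ v, Continuous (e v) := fun v =>
    (by fun_prop : Continuous fun s : ℝ => exp (c * s)).mul v.continuous.Icc_extend'
  have hge : ∀ v, Continuous fun s => g s (e v s) := fun v =>
    hg.comp (continuous_id.prodMk (he v))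
  let J : C(Icc 0 T, ℝ) → ℝ → ℝ := fun v t =>
    x₀ + (1 / Gamma α) * ∫ s in (0:ℝ)..t, (t - s) ^ (α - 1) * g s (e v s)
  have hJ : ∀ v, ContinuousOn (J v) (Icc 0 T) := fun v =>
    continuousOn_const.add (continuousOn_const.mul (continuousOn_integral_sub_rpow_mul hα (hge v)))
  let F : C(Icc 0 T, ℝ) → C(Icc 0 T, ℝ) := fun v =>
    ⟨fun t => exp (-(c * t)) * J v t,
      (by fun_prop : Continuous fun t : Icc 0 T => exp (-(c * (t : ℝ)))).mul (hJ v).domRestrict⟩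
  have hF : ContractingWith (1 / 2) F := by
    refine ⟨by rw [← NNReal.coe_lt_coe]; norm_num, LipschitzWith.of_dist_le_mul fun v w => ?_⟩
    rw [ContinuousMap.dist_le (by positivity)]
    intro t
    have h1 := abs_fractionalIntegral_sub_le hα t.2.1 hL hc hcL (dist_nonneg (x := v) (y := w))
      (hge v).continuousOn (hge w).continuousOn (fun s hs => (hLip s _ _).trans <| by
        rw [mul_assoc]
        refine mul_le_mul_of_nonneg_left ?_ hL.le
        change |exp (c * s) * _ - exp (c * s) * _| ≤ _
        rw [← mul_sub, abs_mul, abs_of_pos (exp_pos _), mul_comm]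
        refine mul_le_mul_of_nonneg_right ?_ (exp_pos _).le
        rw [← dist_eq]
        exact ContinuousMap.dist_apply_le_dist _)
    change |exp (-(c * t)) * J v t - exp (-(c * t)) * J w t| ≤ _
    rw [← mul_sub, abs_mul, abs_of_pos (exp_pos _), add_sub_add_left_eq_sub]
    calc _ ≤ exp (-(c * t)) * (dist v w / 2 * exp (c * t)) :=
          mul_le_mul_of_nonneg_left h1 (exp_pos _).le
      _ = _ := by
        rw [exp_neg]
        have := (exp_pos (c * (t : ℝ))).ne'
        push_cast
        field_simp
  obtain ⟨v, hv⟩ : ∃ v, F v = v := ⟨_, hF.fixedPoint_isFixedPt⟩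
  refine ⟨e v, he v, fun t ht => ?_⟩
  have h1 : exp (-(c * t)) * J v t = v ⟨t, ht⟩ := congrArg (fun w => w ⟨t, ht⟩) hv
  change exp (c * t) * IccExtend hT v t = J v t
  rw [IccExtend_of_mem hT v ht, ← h1, ← mul_assoc, ← exp_add, add_neg_cancel, exp_zero, one_mul]

end VolterraRpowKernel

/-- Two solutions of the equation whose delayed arguments `w₁`, `w₂` agree on `[-r, b]` agree on
`[-r, b + r]`. -/
lemma delayStep_eqOn {α r T L b x₀ : ℝ} (hα : 0 < α) (hL : 0 < L)
    {f : ℝ → ℝ → ℝ → ℝ} {u₁ u₂ w₁ w₂ : ℝ → ℝ}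
    (hf : ContinuousOn (fun p : ℝ × ℝ × ℝ => f p.1 p.2.1 p.2.2)
      (Icc 0 T ×ˢ (univ : Set (ℝ × ℝ))))
    (hLip : ∀ t ∈ Icc (0:ℝ) T, ∀ x y z : ℝ, |f t x z - f t y z| ≤ L * |x - y|)
    (hu₁ : ContinuousOn u₁ (Icc (-r) T)) (hu₂ : ContinuousOn u₂ (Icc (-r) T))
    (hw₁ : ContinuousOn w₁ (Icc (-r) T)) (hr : 0 < r)
    (hw : EqOn w₁ w₂ (Icc (-r) (min b T)))
    (h0 : EqOn u₁ u₂ (Icc (-r) 0))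
    (h₁ : ∀ t ∈ Icc 0 T, u₁ t = x₀ +
      (1 / Gamma α) * ∫ s in (0:ℝ)..t, (t - s) ^ (α - 1) * f s (u₁ s) (w₁ (s - r)))
    (h₂ : ∀ t ∈ Icc 0 T, u₂ t = x₀ +
      (1 / Gamma α) * ∫ s in (0:ℝ)..t, (t - s) ^ (α - 1) * f s (u₂ s) (w₂ (s - r))) :
    EqOn u₁ u₂ (Icc (-r) (min (b + r) T)) := by
  have hsub : Icc 0 (min (b + r) T) ⊆ Icc 0 T := Icc_subset_Icc_right (min_le_right _ _)
  have hsub' : Icc 0 T ⊆ Icc (-r) T := Icc_subset_Icc_left (by linarith)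
  have hcomp : ∀ u : ℝ → ℝ, ContinuousOn u (Icc (-r) T) →
      ContinuousOn (fun s => f s (u s) (w₁ (s - r))) (Icc 0 (min (b + r) T)) := by
    intro u hu
    refine ContinuousOn.comp (f := fun s : ℝ => (s, u s, w₁ (s - r))) hf ?_
      (fun s hs => ⟨hsub hs, mem_univ _⟩)
    refine continuousOn_id.prodMk ((hu.mono (hsub.trans hsub')).prodMk ?_)
    exact hw₁.comp (by fun_prop) fun s hs =>
      ⟨by linarith [hs.1], by linarith [(hsub hs).2]⟩
  have key : EqOn u₁ u₂ (Icc 0 (min (b + r) T)) := by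
    refine fractionalVolterra_eqOn hα hL (g := fun s x => f s x (w₁ (s - r)))
      (fun t ht x y => hLip t (hsub ht) x y _) (hu₁.mono (hsub.trans hsub'))
      (hu₂.mono (hsub.trans hsub')) (hcomp _ hu₁) (hcomp _ hu₂)
      (fun t ht => h₁ t (hsub ht)) (fun t ht => ?_)
    rw [h₂ t (hsub ht)]
    congr 2
    refine intervalIntegral.integral_congr fun s hs => ?_
    rw [uIcc_of_le ht.1] at hs
    have hst : s ≤ min (b + r) T := hs.2.trans ht.2
    have : w₁ (s - r) = w₂ (s - r) := hw ⟨by linarith [hs.1], le_min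
      (by linarith [hst.trans (min_le_left _ _)]) (by linarith [hst.trans (min_le_right _ _)])⟩
    simp only [this]
  intro s hs
  rcases le_total s 0 with h | h
  · exact h0 ⟨hs.1, h⟩
  · exact key ⟨h, hs.2⟩

lemma delayStep_exists {α r T L : ℝ} (hα : 0 < α) (hr : 0 < r) (hT : 0 < T) (hL : 0 < L)
    {f : ℝ → ℝ → ℝ → ℝ} {φ : ℝ → ℝ}
    (hf : ContinuousOn (fun p : ℝ × ℝ × ℝ => f p.1 p.2.1 p.2.2)
      (Icc 0 T ×ˢ (univ : Set (ℝ × ℝ))))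
    (hφ : ContinuousOn φ (Icc (-r) 0))
    (hLip : ∀ t ∈ Icc (0:ℝ) T, ∀ x y z : ℝ, |f t x z - f t y z| ≤ L * |x - y|)
    {w : ℝ → ℝ} (hw : Continuous w) :
    ∃ u : ℝ → ℝ, Continuous u ∧ (∀ t ∈ Icc (-r) 0, u t = φ t) ∧
      ∀ t ∈ Icc 0 T, u t = φ 0 +
        (1 / Gamma α) * ∫ s in (0:ℝ)..t, (t - s) ^ (α - 1) * f s (u s) (w (s - r)) := by
  let p : ℝ → ℝ := fun s => projIcc 0 T hT.le s
  have hp : Continuous p := continuous_subtype_val.comp continuous_projIcc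
  have hpmem : ∀ s, p s ∈ Icc 0 T := fun s => (projIcc 0 T hT.le s).2
  have hpeq : ∀ s ∈ Icc 0 T, p s = s := fun s hs =>
    congrArg Subtype.val (projIcc_of_mem hT.le hs)
  obtain ⟨u, hu, hu'⟩ := fractionalVolterra_exists hα (φ 0) hL hT.le
    (g := fun s x => f (p s) x (w (s - r)))
    (hf.comp_continuous (f := fun q : ℝ × ℝ => (p q.1, q.2, w (q.1 - r))) (by fun_prop)
      (fun q => ⟨hpmem _, mem_univ _⟩)) (fun t x y => hLip _ (hpmem t) x y _)
  have hr' : -r ≤ 0 := by linarith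
  let ψ : ℝ → ℝ := IccExtend hr' ((Icc (-r) 0).domRestrict φ)
  have hψ : Continuous ψ := hφ.domRestrict.Icc_extend'
  have hψeq : ∀ s ∈ Icc (-r) 0, ψ s = φ s := fun s hs => IccExtend_of_mem hr' _ hs
  have hu0 : u 0 = φ 0 := by simpa using hu' 0 ⟨le_rfl, hT.le⟩
  let U : ℝ → ℝ := fun t => if t ≤ 0 then ψ t else u t
  have hUu : ∀ t, 0 ≤ t → U t = u t := by
    intro t ht
    rcases ht.eq_or_lt with rfl | ht
    · simp only [U, le_refl, if_true]
      rw [hu0, hψeq 0 ⟨hr', le_rfl⟩]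
    · simp only [U, if_neg ht.not_ge]
  refine ⟨U, ?_, fun t ht => ?_, fun t ht => ?_⟩
  · refine hψ.if_le hu continuous_id continuous_const fun t ht => ?_
    subst ht
    rw [hu0, hψeq 0 ⟨hr', le_rfl⟩]
  · simp only [U, if_pos ht.2, hψeq t ht]
  · rw [hUu t ht.1, hu' t ht]
    congr 2
    refine intervalIntegral.integral_congr fun s hs => ?_
    rw [uIcc_of_le ht.1] at hs
    simp only [hUu s hs.1, hpeq s ⟨hs.1, hs.2.trans ht.2⟩]

theorem existence_uniqueness_const_delay
    (α r T L : ℝ) (hα0 : 0 < α) (hα1 : α < 1) (hr : 0 < r) (hT : 0 < T) (hL : 0 < L)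
    (f : ℝ → ℝ → ℝ → ℝ) (φ : ℝ → ℝ)
    (hf : ContinuousOn (fun p : ℝ × ℝ × ℝ => f p.1 p.2.1 p.2.2)
      (Set.Icc 0 T ×ˢ (Set.univ : Set (ℝ × ℝ))))
    (hφ : ContinuousOn φ (Set.Icc (-r) 0))
    (hLip : ∀ t ∈ Set.Icc (0:ℝ) T, ∀ υ₁ υ₂ ϑ : ℝ,
      |f t υ₁ ϑ - f t υ₂ ϑ| ≤ L * |υ₁ - υ₂|) :
    ∃ υ : ℝ → ℝ, SolvesConstDelayFDDE α r T f φ υ ∧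
      ∀ υ' : ℝ → ℝ, SolvesConstDelayFDDE α r T f φ υ' → Set.EqOn υ υ' (Set.Icc (-r) T) := by
  have hr' : -r ≤ 0 := by linarith
  have h00 : (0:ℝ) ∈ Icc (-r) 0 := ⟨hr', le_rfl⟩
  choose! W hWc hWφ hW using fun w (hw : Continuous w) =>
    delayStep_exists hα0 hr hT hL hf hφ hLip hw
  let u : ℕ → ℝ → ℝ := fun n => W^[n] (IccExtend hr' ((Icc (-r) 0).domRestrict φ))
  have hsucc : ∀ n, u (n + 1) = W (u n) := fun n => Function.iterate_succ_apply' W n _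
  have huc : ∀ n, Continuous (u n) := by
    intro n
    induction n with
    | zero => exact hφ.domRestrict.Icc_extend'
    | succ n ih => rw [hsucc]; exact hWc _ ih
  have huφ : ∀ n, ∀ t ∈ Icc (-r) 0, u n t = φ t := by
    intro n t ht
    cases n with
    | zero => exact IccExtend_of_mem hr' _ ht
    | succ n => rw [hsucc]; exact hWφ _ (huc n) t ht
  have hu : ∀ n, ∀ t ∈ Icc 0 T, u (n + 1) t = φ 0 + (1 / Gamma α) *
      ∫ s in (0:ℝ)..t, (t - s) ^ (α - 1) * f s (u (n + 1) s) (u n (s - r)) := by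
    intro n
    rw [hsucc]
    exact hW _ (huc n)
  have hstab : ∀ n : ℕ, EqOn (u (n + 1)) (u n) (Icc (-r) (min (n * r) T)) := by
    intro n
    induction n with
    | zero =>
      intro t ht
      have ht' : t ∈ Icc (-r) 0 := ⟨ht.1, by simpa using ht.2.trans (min_le_left _ _)⟩
      rw [huφ _ t ht', huφ _ t ht']
    | succ n ih =>
      have := delayStep_eqOn hα0 hL hf hLip (huc (n + 2)).continuousOn (huc (n + 1)).continuousOn
        (huc (n + 1)).continuousOn hr ih
        (fun t ht => by rw [huφ _ t ht, huφ _ t ht]) (hu (n + 1)) (hu n)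
      rwa [Nat.cast_succ, add_one_mul]
  obtain ⟨N, hN⟩ := exists_nat_ge (T / r)
  have hNT : min (N * r) T = T := min_eq_right ((div_le_iff₀ hr).1 hN)
  have hfix := hstab N
  rw [hNT] at hfix
  have hsol : SolvesConstDelayFDDE α r T f φ (u N) := by
    refine ⟨(huc N).continuousOn, huφ N, fun t ht => ?_⟩
    rw [← hfix ⟨by linarith [ht.1], ht.2⟩, hu N t ht]
    congr 2
    refine intervalIntegral.integral_congr fun s hs => ?_
    rw [uIcc_of_le ht.1] at hs
    simp only [hfix ⟨by linarith [hs.1], hs.2.trans ht.2⟩]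
  refine ⟨u N, hsol, fun v hv => ?_⟩
  have heq0 : EqOn (u N) v (Icc (-r) 0) := fun t ht => by rw [hsol.2.1 t ht, hv.2.1 t ht]
  have hall : ∀ n : ℕ, EqOn (u N) v (Icc (-r) (min (n * r) T)) := by
    intro n
    induction n with
    | zero => exact heq0.mono (Icc_subset_Icc_right (by simp))
    | succ n ih =>
      have := delayStep_eqOn hα0 hL hf hLip hsol.1 hv.1 hsol.1 hr ih heq0 hsol.2.2 hv.2.2
      rwa [Nat.cast_succ, add_one_mul]
  have := hall N
  rwa [hNT] at this
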